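/- arXiv:2503.19694 — 2 statements merged into one kernel-verified Lean document; each statement's English description precedes it below -/
import Mathlib

section
/- Let $\mathbf{d} = (d_1,\dots,d_n)$ be nonnegative integers with $d = \sum_i d_i$, and let $J_{\mathbf{d}} = (x_1^{d_1+1},\dots,x_n^{d_n+1}) \subseteq \mathbb{F}[x_1,\dots,x_n]$, where $\mathbb{F}$ has characteristic zero. Then $L = x_1 + \cdots + x_n$ is a Lefschetz element of $\mathbb{F}[x_1,\dots,x_n]/J_{\mathbf{d}}$: for all $i \le d/2$, multiplication by $L^{d-2i}$ gives a bijection from the degree-$i$ piece to the degree-$(d-i)$ piece. -/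
open MvPolynomial

/-- The degree-`i` piece of the quotient of `F[x₁,…,xₙ]` by a homogeneous
ideal `I`: the image of the homogeneous polynomials of degree `i`. -/
noncomputable def gradedPiece {n : ℕ} (F : Type*) [Field F]
    (I : Ideal (MvPolynomial (Fin n) F)) (i : ℕ) :
    Submodule F (MvPolynomial (Fin n) F ⧸ I) :=
  (MvPolynomial.homogeneousSubmodule (Fin n) F i).map
    (Ideal.Quotient.mkₐ F I).toLinearMap

section Sl2

variable {K A : Type*} [Field K] [AddCommGroup A] [Module K A]
  {E G : Module.End K A} {V : ℤ → A → Prop}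

lemma weight_pow_apply (hE : ∀ w v, V w v → V (w + 2) (E v)) {w : ℤ} {v : A} (hv : V w v)
    (k : ℕ) : V (w + 2 * k) ((E ^ k) v) := by
  induction k with
  | zero => simpa using hv
  | succ k ih =>
    rw [pow_succ', Module.End.mul_apply]
    have := hE _ _ ih
    convert this using 1
    push_cast
    ring

lemma lowering_raising_pow_apply (hE : ∀ w v, V w v → V (w + 2) (E v))
    (hEG : ∀ w v, V w v → E (G v) - G (E v) = (w : K) • v) {m : ℤ} {v : A} (hv : V (-m) v)
    (k : ℕ) :
    G ((E ^ (k + 1)) v) =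
      (E ^ (k + 1)) (G v) + (((k : K) + 1) * ((m : K) - k)) • (E ^ k) v := by
  induction k with
  | zero =>
    have := hEG _ _ hv
    rw [sub_eq_iff_eq_add] at this
    simp [this]
  | succ k ih =>
    have h := hEG _ _ (weight_pow_apply hE hv (k + 1))
    rw [ih] at h
    rw [pow_succ' E (k + 1), Module.End.mul_apply, Module.End.mul_apply]
    rw [sub_eq_iff_eq_add, ← sub_eq_iff_eq_add'] at h
    rw [← h, map_add, map_smul, ← Module.End.mul_apply E (E ^ k), ← pow_succ', add_sub_assoc,
      ← sub_smul]
    congr 2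
    push_cast
    ring

lemma eq_zero_of_raising_pow_eq_zero [CharZero K] (hE : ∀ w v, V w v → V (w + 2) (E v))
    (hG : ∀ w v, V w v → V (w - 2) (G v))
    (hEG : ∀ w v, V w v → E (G v) - G (E v) = (w : K) • v) (k : ℕ) :
    ∀ (m : ℕ) (v : A), V (-m) v → (G ^ k) v = 0 → (E ^ m) v = 0 → v = 0 := by
  induction k with
  | zero => intro m v _ h _; simpa using h
  | succ k ih =>
    intro m v hv hGk hEm
    have hEm' : (E ^ (m + 1)) v = 0 := by rw [pow_succ', Module.End.mul_apply, hEm, map_zero]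
    have hGv : G v = 0 := by
      refine ih (m + 2) (G v) ?_ ?_ ?_
      · convert hG _ _ hv using 1
        push_cast
        ring
      · rwa [pow_succ, Module.End.mul_apply] at hGk
      · have := lowering_raising_pow_apply hE hEG (m := m) hv m
        rw [hEm', map_zero] at this
        simp only [Int.cast_natCast, sub_self, mul_zero, zero_smul, add_zero] at this
        rw [pow_succ', Module.End.mul_apply, ← this, map_zero]
    have key : ∀ j ≤ m, (E ^ (m - j)) v = 0 := by
      intro j
      induction j with
      | zero => intro _; simpa using hEm
      | succ j ihj =>
        intro hj
        have h0 := ihj (by omega)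
        obtain ⟨l, rfl⟩ : ∃ l, m = l + j + 1 := ⟨m - (j + 1), by omega⟩
        rw [show l + j + 1 - j = l + 1 by omega] at h0
        rw [show l + j + 1 - (j + 1) = l by omega]
        have := lowering_raising_pow_apply hE hEG (m := (l + j + 1 : ℕ)) hv l
        rw [h0, map_zero, hGv, map_zero, zero_add] at this
        refine (smul_eq_zero.mp this.symm).resolve_left (mul_ne_zero ?_ ?_)
        · exact_mod_cast l.succ_ne_zero
        · push_cast
          rw [show (l : K) + j + 1 - l = j + 1 by ring]
          exact_mod_cast j.succ_ne_zero
    simpa using key m le_rfl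

end Sl2

/-- If `f` maps `S` into `T`, `g` maps `T` into `S`, both are injective there and `T` is
finite-dimensional, then `f` is a bijection from `S` onto `T`. -/
lemma bijOn_of_mapsTo_of_ker_trivial {K A : Type*} [Field K] [AddCommGroup A] [Module K A]
    (f g : Module.End K A) (S T : Submodule K A) [FiniteDimensional K T]
    (hf : ∀ v ∈ S, f v ∈ T) (hg : ∀ v ∈ T, g v ∈ S)
    (hf0 : ∀ v ∈ S, f v = 0 → v = 0) (hg0 : ∀ v ∈ T, g v = 0 → v = 0) :
    Set.BijOn f S T := by
  refine ⟨hf, ?_, ?_⟩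
  · intro x hx y hy hxy
    exact sub_eq_zero.mp (hf0 _ (S.sub_mem hx hy) (by rw [map_sub, hxy, sub_self]))
  · intro t ht
    let φ : T →ₗ[K] T := (f ∘ₗ g).restrict fun v hv => hf _ (hg v hv)
    have hφ : Function.Injective φ := by
      rw [injective_iff_map_eq_zero]
      rintro ⟨v, hv⟩ h
      have h' : f (g v) = 0 := congrArg Subtype.val h
      exact Subtype.ext (hg0 v hv (hf0 _ (hg v hv) h'))
    obtain ⟨⟨v, hv⟩, h⟩ := LinearMap.injective_iff_surjective.mp hφ ⟨t, ht⟩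
    exact ⟨g v, hg v hv, congrArg Subtype.val h⟩

section Lowering

variable {n : ℕ} {F : Type*} [Field F] (dvec : Fin n → ℕ)

/-- The operator `∑ i, (dᵢ ∂ᵢ - xᵢ ∂ᵢ²)`, which together with multiplication by `∑ i, xᵢ`
generates an action of `𝔰𝔩₂`. -/
noncomputable def lowering : Module.End F (MvPolynomial (Fin n) F) :=
  ∑ i, ((dvec i : F) • (pderiv i).toLinearMap -
    LinearMap.mulLeft F (X i) ∘ₗ (pderiv i).toLinearMap ∘ₗ (pderiv i).toLinearMap)

lemma lowering_apply (p : MvPolynomial (Fin n) F) :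
    lowering dvec p = ∑ i, ((dvec i : MvPolynomial (Fin n) F) * pderiv i p -
      X i * pderiv i (pderiv i p)) := by
  simp [lowering, LinearMap.sum_apply, smul_eq_C_mul]

lemma pderiv_sum_X (i : Fin n) : pderiv i (∑ j, X j : MvPolynomial (Fin n) F) = 1 := by
  simp [map_sum, pderiv_X, Pi.single_apply]

lemma lowering_sum_X_mul {j : ℕ} {p : MvPolynomial (Fin n) F} (hp : p.IsHomogeneous j) :
    (∑ i, X i) * lowering dvec p - lowering dvec ((∑ i, X i) * p) =
      ((2 * (j : ℤ) - (∑ i, dvec i : ℕ) : ℤ) : MvPolynomial (Fin n) F) * p := by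
  have euler := hp.sum_X_mul_pderiv
  rw [nsmul_eq_mul] at euler
  have : ((2 * (j : ℤ) - (∑ i, dvec i : ℕ) : ℤ) : MvPolynomial (Fin n) F) * p =
      ∑ i, (2 * (X i * pderiv i p) - (dvec i : MvPolynomial (Fin n) F) * p) := by
    rw [Finset.sum_sub_distrib, ← Finset.mul_sum, euler, ← Finset.sum_mul]
    push_cast
    ring
  rw [this, lowering_apply, lowering_apply, Finset.mul_sum, ← Finset.sum_sub_distrib]
  refine Finset.sum_congr rfl fun i _ => ?_
  simp only [pderiv_mul, pderiv_sum_X, map_add, one_mul]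
  ring

lemma lowering_isHomogeneous {j : ℕ} {p : MvPolynomial (Fin n) F}
    (hp : p.IsHomogeneous (j + 1)) : (lowering dvec p).IsHomogeneous j := by
  rw [lowering_apply]
  refine IsHomogeneous.sum _ _ _ fun i _ => ?_
  have h1 : (pderiv i p).IsHomogeneous j := hp.pderiv
  refine (homogeneousSubmodule (Fin n) F j).sub_mem ?_ ?_
  · simpa using h1.C_mul (dvec i : F)
  · rw [mem_homogeneousSubmodule]
    obtain _ | j := j
    · rw [← totalDegree_zero_iff_isHomogeneous, totalDegree_eq_zero_iff_eq_C] at h1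
      rw [h1, pderiv_C, mul_zero]
      exact isHomogeneous_zero _ _ _
    · rw [add_comm j 1]
      exact (isHomogeneous_X F i).mul h1.pderiv

lemma lowering_eq_zero {p : MvPolynomial (Fin n) F} (hp : p.IsHomogeneous 0) :
    lowering dvec p = 0 := by
  rw [← totalDegree_zero_iff_isHomogeneous, totalDegree_eq_zero_iff_eq_C] at hp
  rw [lowering_apply, hp]
  simp

lemma lowering_mul_X_pow_mem (i : Fin n) (p : MvPolynomial (Fin n) F) :
    lowering dvec (p * X i ^ (dvec i + 1)) ∈
      Ideal.span {f : MvPolynomial (Fin n) F | ∃ i, f = X i ^ (dvec i + 1)} := by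
  have hX : (X i ^ (dvec i + 1) : MvPolynomial (Fin n) F) ∈
      Ideal.span {f : MvPolynomial (Fin n) F | ∃ i, f = X i ^ (dvec i + 1)} :=
    Ideal.subset_span ⟨i, rfl⟩
  rw [lowering_apply]
  refine Ideal.sum_mem _ fun k _ => ?_
  refine Ideal.mem_of_dvd _ ?_ hX
  by_cases hk : k = i
  · subst hk
    generalize dvec k = e
    refine ⟨(e : MvPolynomial (Fin n) F) * pderiv k p -
      2 * ((e : MvPolynomial (Fin n) F) + 1) * pderiv k p - X k * pderiv k (pderiv k p), ?_⟩
    obtain _ | e := e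
    · simp
      ring
    · simp
      ring
  · have h0 : pderiv k (X i ^ (dvec i + 1) : MvPolynomial (Fin n) F) = 0 := by
      rw [pderiv_pow, pderiv_X_of_ne (Ne.symm hk), mul_zero]
    refine ⟨(dvec k : MvPolynomial (Fin n) F) * pderiv k p - X k * pderiv k (pderiv k p), ?_⟩
    simp only [pderiv_mul, h0, mul_zero, add_zero]
    ring

lemma lowering_mem {p : MvPolynomial (Fin n) F}
    (hp : p ∈ Ideal.span {f : MvPolynomial (Fin n) F | ∃ i, f = X i ^ (dvec i + 1)}) :
    lowering dvec p ∈ Ideal.span {f : MvPolynomial (Fin n) F | ∃ i, f = X i ^ (dvec i + 1)} := by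
  have hrange : {f : MvPolynomial (Fin n) F | ∃ i, f = X i ^ (dvec i + 1)} =
      Set.range fun i => X i ^ (dvec i + 1) := by
    ext f
    simp [eq_comm]
  rw [hrange, Ideal.mem_span_range_iff_exists_fun] at hp
  obtain ⟨c, rfl⟩ := hp
  rw [map_sum]
  exact Ideal.sum_mem _ fun i _ => lowering_mul_X_pow_mem dvec i (c i)

lemma exists_lowering_quotient {J : Ideal (MvPolynomial (Fin n) F)}
    (hJ : J = Ideal.span {f | ∃ i : Fin n, f = X i ^ (dvec i + 1)}) :
    ∃ G : Module.End F (MvPolynomial (Fin n) F ⧸ J), ∀ p,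
      G (Ideal.Quotient.mk J p) = Ideal.Quotient.mk J (lowering dvec p) := by
  let e := Submodule.Quotient.restrictScalarsEquiv F J
  let G := (J.restrictScalars F).mapQ (J.restrictScalars F) (lowering dvec) fun p hp => by
    subst hJ
    exact lowering_mem dvec hp
  exact ⟨e.toLinearMap ∘ₗ G ∘ₗ e.symm.toLinearMap, fun p => rfl⟩

end Lowering

section GradedPiece

variable {n : ℕ} {F : Type*} [Field F]

lemma mem_gradedPiece {I : Ideal (MvPolynomial (Fin n) F)} {i : ℕ}
    {v : MvPolynomial (Fin n) F ⧸ I} :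
    v ∈ gradedPiece F I i ↔
      ∃ p : MvPolynomial (Fin n) F, p.IsHomogeneous i ∧ Ideal.Quotient.mk I p = v :=
  Iff.rfl

instance finiteDimensional_gradedPiece (I : Ideal (MvPolynomial (Fin n) F)) (i : ℕ) :
    FiniteDimensional F (gradedPiece F I i) :=
  Module.Finite.iff_fg.mpr ((homogeneousSubmodule_fg (Fin n) F i).map _)

lemma mk_sum_X_isNilpotent {dvec : Fin n → ℕ} {J : Ideal (MvPolynomial (Fin n) F)}
    (hJ : J = Ideal.span {f | ∃ i : Fin n, f = X i ^ (dvec i + 1)}) :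
    IsNilpotent (Ideal.Quotient.mk J (∑ i : Fin n, X i)) := by
  rw [map_sum]
  refine isNilpotent_sum fun i _ => ⟨dvec i + 1, ?_⟩
  rw [← map_pow, Ideal.Quotient.eq_zero_iff_mem, hJ]
  exact Ideal.subset_span ⟨i, rfl⟩

/-- The vectors of weight `w` when the degree-`j` piece of a quotient is given weight `2j - d`. -/
def HasLefschetzWeight (d : ℕ) (J : Ideal (MvPolynomial (Fin n) F)) (w : ℤ)
    (v : MvPolynomial (Fin n) F ⧸ J) : Prop :=
  v = 0 ∨ ∃ j : ℕ, 2 * (j : ℤ) - d = w ∧ v ∈ gradedPiece F J j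

end GradedPiece

/-- `L = x₁ + ⋯ + xₙ` is a Lefschetz element of
`𝔽[x₁,…,xₙ]/(x₁^{d₁+1},…,xₙ^{dₙ+1})`: for all `i ≤ d/2`, multiplication by
`L^{d-2i}` is a bijection from the degree-`i` piece onto the
degree-`(d-i)` piece. -/
theorem lefschetz_element_monomial_complete_intersection
    {n : ℕ} (F : Type*) [Field F] [CharZero F]
    (dvec : Fin n → ℕ) (d : ℕ) (hd : d = ∑ i, dvec i)
    (J : Ideal (MvPolynomial (Fin n) F))
    (hJ : J = Ideal.span {f | ∃ i : Fin n, f = X i ^ (dvec i + 1)}) :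
    ∀ i : ℕ, 2 * i ≤ d →
      Set.BijOn (fun q => q * (Ideal.Quotient.mk J (∑ i : Fin n, X i)) ^ (d - 2 * i))
        (gradedPiece F J i) (gradedPiece F J (d - i)) := by
  intro i hi
  obtain ⟨G, hG⟩ := exists_lowering_quotient dvec hJ
  set L := Ideal.Quotient.mk J (∑ i : Fin n, X i) with hL
  let E : Module.End F (MvPolynomial (Fin n) F ⧸ J) := LinearMap.mulRight F L
  have hE_apply : ∀ v, E v = v * L := fun _ => rfl
  have hE_pow : ∀ k v, (E ^ k) v = v * L ^ k := fun k v => by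
    rw [LinearMap.pow_mulRight, LinearMap.mulRight_apply]
  have hE_mem : ∀ j, ∀ v ∈ gradedPiece F J j, E v ∈ gradedPiece F J (j + 1) := by
    rintro j _ ⟨p, hp, rfl⟩
    exact ⟨p * ∑ i, X i,
      hp.mul (IsHomogeneous.sum _ _ _ fun i _ => isHomogeneous_X F i),
      map_mul (Ideal.Quotient.mk J) _ _⟩
  have hG_mem : ∀ j, ∀ v ∈ gradedPiece F J (j + 1), G v ∈ gradedPiece F J j := by
    rintro j _ ⟨p, hp, rfl⟩
    exact ⟨lowering dvec p, lowering_isHomogeneous dvec hp, (hG p).symm⟩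
  have hG_zero : ∀ v ∈ gradedPiece F J 0, G v = 0 := by
    rintro _ ⟨p, hp, rfl⟩
    exact (hG p).trans (by rw [lowering_eq_zero dvec hp, map_zero])
  have hE_pow_mem : ∀ k j, ∀ v ∈ gradedPiece F J j, (E ^ k) v ∈ gradedPiece F J (j + k) := by
    intro k j v hv
    induction k with
    | zero => simpa using hv
    | succ k ih => rw [pow_succ', Module.End.mul_apply]; exact hE_mem _ _ ih
  have hG_pow_mem : ∀ k j, ∀ v ∈ gradedPiece F J (j + k), (G ^ k) v ∈ gradedPiece F J j := by
    intro k
    induction k with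
    | zero => intro j v hv; simpa using hv
    | succ k ih =>
      intro j v hv
      rw [pow_succ, Module.End.mul_apply]
      exact ih _ _ (hG_mem _ _ hv)
  have hG_nil : ∀ j, ∀ v ∈ gradedPiece F J j, (G ^ (j + 1)) v = 0 := by
    intro j v hv
    rw [pow_succ', Module.End.mul_apply]
    exact hG_zero _ (hG_pow_mem j 0 v (by rwa [zero_add]))
  obtain ⟨N, hN⟩ := mk_sum_X_isNilpotent hJ
  have hE_nil : ∀ v, (E ^ N) v = 0 := fun v => by rw [hE_pow, hN, mul_zero]
  have hVE : ∀ w v, HasLefschetzWeight d J w v → HasLefschetzWeight d J (w + 2) (E v) := by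
    rintro w v (rfl | ⟨j, hj, hv⟩)
    · exact Or.inl (map_zero _)
    · exact Or.inr ⟨j + 1, by push_cast; linarith, hE_mem _ _ hv⟩
  have hVG : ∀ w v, HasLefschetzWeight d J w v → HasLefschetzWeight d J (w - 2) (G v) := by
    rintro w v (rfl | ⟨j, hj, hv⟩)
    · exact Or.inl (map_zero _)
    · obtain _ | j := j
      · exact Or.inl (hG_zero v hv)
      · exact Or.inr ⟨j, by push_cast at hj; linarith, hG_mem _ _ hv⟩
  have hEG : ∀ w v, HasLefschetzWeight d J w v → E (G v) - G (E v) = (w : F) • v := by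
    rintro w v (rfl | ⟨j, rfl, hv⟩)
    · simp
    · obtain ⟨p, hp, rfl⟩ := mem_gradedPiece.mp hv
      rw [hE_apply, hE_apply, hG, hL, ← map_mul, ← map_mul, hG, ← map_sub, mul_comm,
        mul_comm p, lowering_sum_X_mul dvec hp, ← hd, map_mul, map_intCast, Int.cast_smul_eq_zsmul,
        zsmul_eq_mul]
  have hweight : ∀ j, ∀ v ∈ gradedPiece F J j, HasLefschetzWeight d J (2 * (j : ℤ) - d) v :=
    fun j v hv => Or.inr ⟨j, rfl, hv⟩
  obtain ⟨m, hm⟩ : ∃ m, d = 2 * i + m := ⟨d - 2 * i, by omega⟩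
  rw [show d - 2 * i = m by omega, show d - i = i + m by omega]
  have hbij := bijOn_of_mapsTo_of_ker_trivial (E ^ m) (G ^ m) (gradedPiece F J i)
    (gradedPiece F J (i + m)) (hE_pow_mem m i) (hG_pow_mem m i)
    (fun v hv h => by
      refine eq_zero_of_raising_pow_eq_zero hVE hVG hEG (i + 1) m v ?_ (hG_nil i v hv) h
      convert hweight i v hv using 1
      rw [hm]
      push_cast
      ring)
    (fun v hv h => by
      refine eq_zero_of_raising_pow_eq_zero (V := fun w => HasLefschetzWeight d J (-w))
        (E := G) (G := E) ?_ ?_ ?_ N m v ?_ (hE_nil v) h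
      · intro w v hv
        convert hVG _ _ hv using 1
        ring
      · intro w v hv
        convert hVE _ _ hv using 1
        ring
      · intro w v hv
        rw [← neg_sub, hEG _ _ hv, Int.cast_neg, neg_smul, neg_neg]
      · convert hweight _ v hv using 1
        rw [hm]
        push_cast
        ring)
  exact hbij.congr fun v _ => hE_pow m v
end

section
/- Let $\alpha,\beta$ be weak compositions of $n$ with lengths $k, p$ and let $\mathcal{C}_{\alpha,\beta}$ be the set of $k \times p$ nonnegative integer matrices with row sums $\alpha$ and column sums $\beta$, viewed as a finite point set in $\mathrm{Mat}_{k\times p}(\mathbb{F})$, $\mathbb{F}$ of characteristic zero. Then each generator of $I_{\alpha,\beta}$ lies in the associated graded ideal $\mathrm{gr}\,\mathbf{I}(\mathcal{C}_{\alpha,\beta})$ of the vanishing ideal of $\mathcal{C}_{\alpha,\beta}$; in particular $I_{\alpha,\beta} \subseteq \mathrm{gr}\,\mathbf{I}(\mathcal{C}_{\alpha,\beta})$. -/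
open MvPolynomial

/-- The contingency-table ideal `I_{α,β} ⊆ 𝔽[x_{k×p}]`. -/
noncomputable def contingencyIdeal {k p : ℕ} (F : Type*) [Field F]
    (α : Fin k → ℕ) (β : Fin p → ℕ) : Ideal (MvPolynomial (Fin k × Fin p) F) :=
  Ideal.span
    ({f | ∃ i : Fin k, f = ∑ j : Fin p, X (i, j)} ∪
     {f | ∃ j : Fin p, f = ∑ i : Fin k, X (i, j)} ∪
     {f | ∃ i : Fin k, ∃ a : Fin p → ℕ, α i < ∑ j, a j ∧
        f = ∏ j : Fin p, X (i, j) ^ a j} ∪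
     {f | ∃ j : Fin p, ∃ b : Fin k → ℕ, β j < ∑ i, b i ∧
        f = ∏ i : Fin k, X (i, j) ^ b i})

/-- The vanishing ideal of a set of `ℕ`-matrices viewed as points of
`Mat_{k×p}(𝔽)`. -/
noncomputable def matrixVanishingIdeal {k p : ℕ} (F : Type*) [Field F]
    (Z : Set (Fin k → Fin p → ℕ)) : Ideal (MvPolynomial (Fin k × Fin p) F) where
  carrier := {f | ∀ A ∈ Z, eval (fun q => (A q.1 q.2 : F)) f = 0}
  add_mem' := by
    intro f g hf hg A hA
    simp only [map_add, hf A hA, hg A hA, add_zero]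
  zero_mem' := by intro A hA; simp
  smul_mem' := by
    intro c f hf A hA
    simp only [smul_eq_mul, map_mul, hf A hA, mul_zero]

/-- The associated graded ideal `gr I`: generated by the top-degree
homogeneous components `τ(f)` of the nonzero `f ∈ I`. -/
noncomputable def grIdeal {σ : Type*} {F : Type*} [Field F]
    (I : Ideal (MvPolynomial σ F)) : Ideal (MvPolynomial σ F) :=
  Ideal.span {g | ∃ f ∈ I, f ≠ 0 ∧ g = homogeneousComponent f.totalDegree f}

namespace MvPolynomial

variable {σ R : Type*} [CommSemiring R]

theorem homogeneousComponent_mul_of_totalDegree_le {f g : MvPolynomial σ R} {d e : ℕ}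
    (hf : f.totalDegree ≤ d) (hg : g.totalDegree ≤ e) :
    homogeneousComponent (d + e) (f * g) =
      homogeneousComponent d f * homogeneousComponent e g := by
  classical
  have coeff_eq_zero {h : MvPolynomial σ R} {c : ℕ} (hh : h.totalDegree ≤ c) {m : σ →₀ ℕ}
      (hm : c < m.degree) : coeff m h = 0 :=
    coeff_eq_zero_of_totalDegree_lt (hh.trans_lt hm)
  ext m
  rw [coeff_homogeneousComponent, coeff_mul, coeff_mul]
  trans ∑ x ∈ Finset.HasAntidiagonal.antidiagonal m,
    if m.degree = d + e then coeff x.1 f * coeff x.2 g else 0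
  · split_ifs <;> simp
  refine Finset.sum_congr rfl fun x hx => ?_
  have hm : m.degree = x.1.degree + x.2.degree := by
    rw [← Finset.HasAntidiagonal.mem_antidiagonal.mp hx, map_add]
  simp only [coeff_homogeneousComponent, hm]
  rcases lt_or_ge d x.1.degree with h₁ | h₁
  · simp [coeff_eq_zero hf h₁]
  rcases lt_or_ge e x.2.degree with h₂ | h₂
  · simp [coeff_eq_zero hg h₂]
  by_cases h : x.1.degree = d
  · simp [h]
  · rw [if_neg (by omega), if_neg h, zero_mul]

theorem homogeneousComponent_prod_of_totalDegree_le {ι : Type*} (s : Finset ι)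
    {f : ι → MvPolynomial σ R} {d : ι → ℕ} (hf : ∀ i ∈ s, (f i).totalDegree ≤ d i) :
    homogeneousComponent (∑ i ∈ s, d i) (∏ i ∈ s, f i) =
      ∏ i ∈ s, homogeneousComponent (d i) (f i) := by
  classical
  induction s using Finset.induction_on with
  | empty => simp [homogeneousComponent_zero]
  | insert i s hi ih =>
    rw [Finset.forall_mem_insert] at hf
    rw [Finset.sum_insert hi, Finset.prod_insert hi, Finset.prod_insert hi,
      homogeneousComponent_mul_of_totalDegree_le hf.1
        ((totalDegree_finsetProd s f).trans (Finset.sum_le_sum hf.2)), ih hf.2]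

end MvPolynomial

section GradedIdeal

variable {σ F : Type*} [Field F] {I : Ideal (MvPolynomial σ F)}

theorem homogeneousComponent_mem_grIdeal {f : MvPolynomial σ F} {d : ℕ} (hf : f ∈ I)
    (hd : f.totalDegree ≤ d) : homogeneousComponent d f ∈ grIdeal I := by
  rcases hd.lt_or_eq with h | rfl
  · simp [homogeneousComponent_eq_zero _ _ h]
  · by_cases h : f = 0
    · simp [h]
    · exact Ideal.subset_span ⟨f, hf, h, rfl⟩

theorem mem_grIdeal_of_sub_C_mem {g : MvPolynomial σ F} {d : ℕ} (hg : g.IsHomogeneous d)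
    (hd : d ≠ 0) {c : F} (h : g - C c ∈ I) : g ∈ grIdeal I := by
  have hle : (g - C c).totalDegree ≤ d :=
    (totalDegree_sub_C_le g c).trans hg.totalDegree_le
  have := homogeneousComponent_mem_grIdeal h hle
  rwa [map_sub, homogeneousComponent_of_mem hg, if_pos rfl,
    homogeneousComponent_eq_zero _ _ (by simpa using Nat.pos_of_ne_zero hd), sub_zero] at this

theorem homogeneousComponent_one_X_sub_C (s : σ) (c : F) :
    homogeneousComponent 1 (X s - C c) = X s := by
  rw [map_sub, homogeneousComponent_of_mem (isHomogeneous_X F s), if_pos rfl,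
    homogeneousComponent_eq_zero _ _ (by simp), sub_zero]

/-- A monomial is the leading form of the corresponding product of falling factorials. -/
theorem prod_X_pow_mem_grIdeal {ι : Type*} [Fintype ι] (v : ι → σ) (a : ι → ℕ)
    (h : ∏ j, ∏ t ∈ Finset.range (a j), (X (v j) - C (t : F)) ∈ I) :
    ∏ j, X (v j) ^ a j ∈ grIdeal I := by
  have hlin (j : ι) (t : ℕ) : (X (v j) - C (t : F)).totalDegree ≤ 1 :=
    (totalDegree_sub_C_le _ _).trans (totalDegree_X _).le
  have hfac (j : ι) :
      (∏ t ∈ Finset.range (a j), (X (v j) - C (t : F))).totalDegree ≤ a j :=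
    (totalDegree_finsetProd _ _).trans
      ((Finset.sum_le_sum fun t _ => hlin j t).trans (by simp))
  have htop (j : ι) :
      homogeneousComponent (a j) (∏ t ∈ Finset.range (a j), (X (v j) - C (t : F))) =
        X (v j) ^ a j := by
    have := homogeneousComponent_prod_of_totalDegree_le (Finset.range (a j))
      fun t _ => hlin j t
    simpa only [homogeneousComponent_one_X_sub_C, Finset.sum_const, Finset.prod_const,
      Finset.card_range, smul_eq_mul, mul_one] using this
  have := homogeneousComponent_mem_grIdeal h
    ((totalDegree_finsetProd _ _).trans (Finset.sum_le_sum fun j _ => hfac j))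
  rw [homogeneousComponent_prod_of_totalDegree_le _ fun j _ => hfac j] at this
  simpa only [htop] using this

end GradedIdeal

theorem eval_prod_X_sub_C_eq_zero {σ ι F : Type*} [Field F] [Fintype ι] (v : ι → σ)
    (a : ι → ℕ) (A : σ → ℕ) (h : ∑ j, A (v j) < ∑ j, a j) :
    eval (fun q => (A q : F)) (∏ j, ∏ t ∈ Finset.range (a j), (X (v j) - C (t : F))) = 0 := by
  obtain ⟨j, -, hj⟩ := Finset.exists_lt_of_sum_lt h
  rw [map_prod]
  refine Finset.prod_eq_zero (Finset.mem_univ j) ?_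
  rw [map_prod]
  exact Finset.prod_eq_zero (Finset.mem_range.mpr hj) (by simp)

/-- Each generator of `I_{α,β}` lies in `gr 𝐈(𝒞_{α,β})`; in particular
`I_{α,β} ⊆ gr 𝐈(𝒞_{α,β})`. -/
theorem contingencyIdeal_le_grIdeal_vanishingIdeal
    {k p : ℕ} (F : Type*) [Field F] [CharZero F]
    (n : ℕ) (α : Fin k → ℕ) (β : Fin p → ℕ)
    (hα : ∑ i, α i = n) (hβ : ∑ j, β j = n) :
    contingencyIdeal F α β ≤
      grIdeal (matrixVanishingIdeal F
        {A : Fin k → Fin p → ℕ |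
          (∀ i, ∑ j, A i j = α i) ∧ (∀ j, ∑ i, A i j = β j)}) := by
  refine Ideal.span_le.mpr ?_
  rintro f (((⟨i, rfl⟩ | ⟨j, rfl⟩) | ⟨i, a, ha, rfl⟩) | ⟨j, b, hb, rfl⟩)
  · refine mem_grIdeal_of_sub_C_mem (c := (α i : F))
      (IsHomogeneous.sum _ _ 1 fun j _ => isHomogeneous_X F (i, j)) one_ne_zero ?_
    rintro A ⟨hrow, -⟩
    simp [← hrow i]
  · refine mem_grIdeal_of_sub_C_mem (c := (β j : F))
      (IsHomogeneous.sum _ _ 1 fun i _ => isHomogeneous_X F (i, j)) one_ne_zero ?_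
    rintro A ⟨-, hcol⟩
    simp [← hcol j]
  · refine prod_X_pow_mem_grIdeal (fun j => (i, j)) a ?_
    rintro A ⟨hrow, -⟩
    exact eval_prod_X_sub_C_eq_zero (fun j => (i, j)) a
      (fun q => A q.1 q.2) ((hrow i).trans_lt ha)
  · refine prod_X_pow_mem_grIdeal (fun i => (i, j)) b ?_
    rintro A ⟨-, hcol⟩
    exact eval_prod_X_sub_C_eq_zero (fun i => (i, j)) b
      (fun q => A q.1 q.2) ((hcol j).trans_lt hb)
end
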